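/- Fix a party q ∈ Fin 5 and let i be a bifurcation choice belonging to I_ch^q, i.e. the number of parties q' ≠ q with i_lost^{q'} = q equals exactly 3, and i_lost^{i_ch^q} = q. Then there exists exactly one voting configuration compatible with i. -/

import Mathlib

open Finset

/-- A voting configuration on 5 parties: binary chancellor/president votes
`vch q k`, `vpr q k` (vote of party `q` for party `k`; the diagonal is
normalized to `0` since only pairs with `k ≠ q` carry a vote), and binary
labels `lch q` (is `q` chancellor?) and `lpr q` (is `q` president?). -/
structure Config where
  vch : Fin 5 → Fin 5 → ℕ
  vpr : Fin 5 → Fin 5 → ℕ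
  lch : Fin 5 → ℕ
  lpr : Fin 5 → ℕ
  vch_le : ∀ q k, vch q k ≤ 1
  vpr_le : ∀ q k, vpr q k ≤ 1
  lch_le : ∀ q, lch q ≤ 1
  lpr_le : ∀ q, lpr q ≤ 1
  vch_diag : ∀ q, vch q q = 0
  vpr_diag : ∀ q, vpr q q = 0

/-- The constraints (i)–(iv) on a voting configuration. -/
def Config.Satisfies (c : Config) : Prop :=
  (∀ q, ∑ k ∈ univ.filter (· ≠ q), c.vch q k ≤ 1) ∧
  (∀ q, ∑ k ∈ univ.filter (· ≠ q), c.vpr q k ≤ c.lch q) ∧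
  (∀ q, (c.lch q = 1 ↔ 3 ≤ ∑ k ∈ univ.filter (· ≠ q), c.vch k q)) ∧
  (∀ q, c.lpr q = ∑ k ∈ univ.filter (· ≠ q),
      c.vpr k q *
        (if 3 ≤ ∑ q' ∈ univ.filter (fun x => x ≠ k ∧ x ≠ q), c.vch q' k then 1 else 0))

/-- A bifurcation choice: for each party `q`, a party `ilost q ≠ q`
(its chancellor vote if it lost) and a party `ich q ≠ q`
(its president vote if it is chancellor). -/
structure Bif where
  ilost : Fin 5 → Fin 5
  ich : Fin 5 → Fin 5
  ilost_ne : ∀ q, ilost q ≠ q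
  ich_ne : ∀ q, ich q ≠ q

/-- Compatibility of a voting configuration with a bifurcation choice. -/
def Compatible (c : Config) (i : Bif) : Prop :=
  c.Satisfies ∧
  (∀ q, ¬ (c.lch q = 1 ∧ c.lpr q = 1)) ∧
  (∀ q k, k ≠ q →
    ((c.lch q = 0 ∧ c.lpr q = 0) →
      c.vch q k = (if k = i.ilost q then 1 else 0) ∧ c.vpr q k = 0) ∧
    ((c.lch q = 1 ∧ c.lpr q = 0) →
      c.vch q k = 0 ∧ c.vpr q k = (if k = i.ich q then 1 else 0)) ∧
    ((c.lch q = 0 ∧ c.lpr q = 1) →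
      c.vch q k = 0 ∧ c.vpr q k = 0))

/-- `I_lost`: every party receives strictly fewer than 3 lost-votes. -/
def ILost (i : Bif) : Prop :=
  ∀ q : Fin 5, (univ.filter (fun q' => q' ≠ q ∧ i.ilost q' = q)).card < 3

/-- `I_ch^q`: exactly 3 parties lost-vote for `q`, and the party `q` would
president-vote for lost-votes for `q`. -/
def ICh (q : Fin 5) (i : Bif) : Prop :=
  (univ.filter (fun q' => q' ≠ q ∧ i.ilost q' = q)).card = 3 ∧ i.ilost (i.ich q) = q

/-- `I_pr^{q,q'}`: at least 3 parties outside `{q, q'}` lost-vote for `q`,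
and `q` would president-vote for `q'`. -/
def IPr (q q' : Fin 5) (i : Bif) : Prop :=
  3 ≤ (univ.filter (fun k => k ≠ q ∧ k ≠ q' ∧ i.ilost k = q)).card ∧ i.ich q = q'

/-- The parties other than `r` whose lost-vote goes to `r`. -/
def lostVoters (i : Bif) (r : Fin 5) : Finset (Fin 5) :=
  univ.filter (fun k => k ≠ r ∧ i.ilost k = r)

theorem card_lostVoters_lt {q r : Fin 5} {i : Bif} (hi : ICh q i) (hr : r ≠ q) :
    (lostVoters i r).card < 3 := by
  have hq : (lostVoters i q).card = 3 := hi.1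
  have hd : Disjoint (lostVoters i q) (lostVoters i r) := by
    rw [Finset.disjoint_left]
    intro k hk hk'
    simp only [lostVoters, mem_filter, mem_univ, true_and] at hk hk'
    exact hr (hk'.2.symm.trans hk.2)
  have h := card_le_univ (lostVoters i q ∪ lostVoters i r)
  rw [card_union_of_disjoint hd, Fintype.card_fin] at h
  omega

theorem card_lostVoters_erase_lt {q : Fin 5} {i : Bif} (hi : ICh q i) :
    ((lostVoters i q).erase (i.ich q)).card < 3 := by
  have hq : (lostVoters i q).card = 3 := hi.1
  have hmem : i.ich q ∈ lostVoters i q := by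
    simp [lostVoters, i.ich_ne q, hi.2]
  rw [card_erase_of_mem hmem]
  omega

/-- If every chancellor vote for `r` is a lost-vote, then the votes for `r` cast within `s`
are at most as many as the lost-voters of `r` in `s`. -/
theorem sum_le_card_lostVoters {v : Fin 5 → Fin 5 → ℕ} {i : Bif} (r : Fin 5) (s : Finset (Fin 5))
    (hs : r ∉ s) (h : ∀ k, k ≠ r → v k r ≤ if r = i.ilost k then 1 else 0) :
    ∑ k ∈ s, v k r ≤ (s ∩ lostVoters i r).card := by
  calc ∑ k ∈ s, v k r ≤ ∑ k ∈ s, if k ∈ lostVoters i r then 1 else 0 := by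
        refine sum_le_sum fun k hk => ?_
        have hkr : k ≠ r := fun e => hs (e ▸ hk)
        simpa [lostVoters, hkr, Ne.symm hkr, eq_comm] using h k hkr
    _ = (s ∩ lostVoters i r).card := by
        rw [← card_filter, filter_mem_eq_inter]

theorem sum_ne_eq_card_lostVoters {v : Fin 5 → Fin 5 → ℕ} {i : Bif} (r : Fin 5)
    (h : ∀ k, k ≠ r → v k r = if r = i.ilost k then 1 else 0) :
    ∑ k ∈ univ.filter (· ≠ r), v k r = (lostVoters i r).card := by
  rw [lostVoters, ← filter_filter, card_filter]
  refine sum_congr rfl fun k hk => ?_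
  rw [h k (by simpa using hk)]
  simp [eq_comm]

theorem sum_ne_le_card_lostVoters {v : Fin 5 → Fin 5 → ℕ} {i : Bif} (r : Fin 5)
    (h : ∀ k, k ≠ r → v k r ≤ if r = i.ilost k then 1 else 0) :
    ∑ k ∈ univ.filter (· ≠ r), v k r ≤ (lostVoters i r).card :=
  (sum_le_card_lostVoters r _ (by simp) h).trans (card_le_card inter_subset_right)

theorem sum_ne_ich_lt {v : Fin 5 → Fin 5 → ℕ} {q : Fin 5} {i : Bif} (hi : ICh q i)
    (h : ∀ k, k ≠ q → v k q ≤ if q = i.ilost k then 1 else 0) :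
    ∑ k ∈ univ.filter (fun x => x ≠ q ∧ x ≠ i.ich q), v k q < 3 := by
  refine ((sum_le_card_lostVoters q _ (by simp) h).trans (card_le_card ?_)).trans_lt
    (card_lostVoters_erase_lt hi)
  intro k hk
  simp only [mem_inter, mem_filter, mem_univ, true_and] at hk
  exact mem_erase.2 ⟨hk.1.2, hk.2⟩

theorem Compatible.vch_le_ilost {c : Config} {i : Bif} (h : Compatible c i) {k r : Fin 5}
    (hkr : k ≠ r) : c.vch k r ≤ if r = i.ilost k then 1 else 0 := by
  obtain ⟨-, hne, hv⟩ := h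
  have h1 := c.lch_le k
  have h2 := c.lpr_le k
  have h3 := hne k
  obtain ⟨ha, hb, hc⟩ := hv k r hkr.symm
  by_cases hl : c.lch k = 0
  · by_cases hp : c.lpr k = 0
    · exact (ha ⟨hl, hp⟩).1.le
    · rw [(hc ⟨hl, by omega⟩).1]
      exact Nat.zero_le _
  · rw [(hb ⟨by omega, by omega⟩).1]
    exact Nat.zero_le _

theorem Compatible.vpr_le_lch {c : Config} {i : Bif} (h : Compatible c i) {k r : Fin 5}
    (hkr : k ≠ r) : c.vpr k r ≤ c.lch k :=
  (single_le_sum (f := fun r => c.vpr k r) (fun _ _ => Nat.zero_le _)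
    (by simpa using hkr.symm)).trans (h.1.2.1 k)

theorem Compatible.lch_eq_zero {c : Config} {q r : Fin 5} {i : Bif} (h : Compatible c i)
    (hi : ICh q i) (hr : r ≠ q) : c.lch r = 0 := by
  have h1 := c.lch_le r
  have h2 := (h.1.2.2.1 r).1
  have h3 := sum_ne_le_card_lostVoters (v := c.vch) r fun k hk => h.vch_le_ilost hk
  have h4 := card_lostVoters_lt hi hr
  by_contra h5
  have h6 := h2 (by omega)
  omega

theorem Compatible.lch_eq_one {c : Config} {q : Fin 5} {i : Bif} (h : Compatible c i)
    (hi : ICh q i) : c.lch q = 1 := by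
  by_contra hq
  have hl : ∀ r, c.lch r = 0 := fun r => by
    by_cases hr : r = q
    · have := c.lch_le q
      subst hr
      omega
    · exact h.lch_eq_zero hi hr
  have hp : ∀ r, c.lpr r = 0 := fun r => by
    rw [h.1.2.2.2 r]
    refine sum_eq_zero fun k hk => ?_
    have h1 := h.vpr_le_lch (show k ≠ r by simpa using hk)
    rw [hl k, Nat.le_zero] at h1
    rw [h1, zero_mul]
  refine hq ((h.1.2.2.1 q).2 ?_)
  rw [sum_ne_eq_card_lostVoters (i := i) q
    fun k hk => ((h.2.2 k q hk.symm).1 ⟨hl k, hp k⟩).1]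
  exact hi.1.ge

theorem Compatible.lpr_eq_zero {c : Config} {q : Fin 5} {i : Bif} (h : Compatible c i)
    (hi : ICh q i) (r : Fin 5) : c.lpr r = 0 := by
  rw [h.1.2.2.2 r]
  refine sum_eq_zero fun k hk => ?_
  have hkr : k ≠ r := by simpa using hk
  by_cases hkq : k = q
  · subst hkq
    have hl := h.lch_eq_one hi
    have h1 := c.lpr_le k
    have h2 := h.2.1 k
    have h3 := ((h.2.2 k r hkr.symm).2.1 ⟨hl, by omega⟩).2
    by_cases hr : r = i.ich k
    · subst hr
      rw [if_neg (sum_ne_ich_lt hi fun j hj => h.vch_le_ilost hj).not_ge, mul_zero]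
    · rw [h3, if_neg hr, zero_mul]
  · have h1 := h.vpr_le_lch hkr
    rw [h.lch_eq_zero hi hkq, Nat.le_zero] at h1
    rw [h1, zero_mul]

/-- The configuration in which `q` is chancellor and all the other parties lost. -/
def chancellorConfig (q : Fin 5) (i : Bif) : Config where
  vch k r := if k ≠ q ∧ r = i.ilost k then 1 else 0
  vpr k r := if k = q ∧ r = i.ich k then 1 else 0
  lch k := if k = q then 1 else 0
  lpr _ := 0
  vch_le _ _ := by split_ifs <;> simp
  vpr_le _ _ := by split_ifs <;> simp
  lch_le _ := by split_ifs <;> simp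
  lpr_le _ := by simp
  vch_diag k := by simp [(i.ilost_ne k).symm]
  vpr_diag k := by simp [(i.ich_ne k).symm]

theorem chancellorConfig_vch_le (q : Fin 5) (i : Bif) (k r : Fin 5) :
    (chancellorConfig q i).vch k r ≤ if r = i.ilost k then 1 else 0 := by
  simp only [chancellorConfig]
  split_ifs <;> simp_all

theorem chancellorConfig_satisfies {q : Fin 5} {i : Bif} (hi : ICh q i) :
    (chancellorConfig q i).Satisfies := by
  refine ⟨fun k => ?_, fun k => ?_, fun r => ?_, fun r => ?_⟩
  · by_cases hk : k = q <;> simp [chancellorConfig, hk, i.ilost_ne]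
  · by_cases hk : k = q <;> simp [chancellorConfig, hk, i.ich_ne]
  · by_cases hr : r = q
    · subst hr
      rw [sum_ne_eq_card_lostVoters (i := i) r fun k hk => by simp [chancellorConfig, hk]]
      simpa [chancellorConfig, lostVoters] using hi.1.ge
    · have h1 := sum_ne_le_card_lostVoters (v := (chancellorConfig q i).vch) r
        fun k _ => chancellorConfig_vch_le q i k r
      have h2 := card_lostVoters_lt hi hr
      have h3 : (chancellorConfig q i).lch r = 0 := by simp [chancellorConfig, hr]
      omega
  · refine (sum_eq_zero fun k _ => ?_).symm
    by_cases hkr : k = q ∧ r = i.ich k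
    · obtain ⟨rfl, rfl⟩ := hkr
      rw [if_neg (sum_ne_ich_lt hi fun j _ => chancellorConfig_vch_le k i j k).not_ge, mul_zero]
    · simp [chancellorConfig, hkr]

theorem chancellorConfig_compatible {q : Fin 5} {i : Bif} (hi : ICh q i) :
    Compatible (chancellorConfig q i) i := by
  refine ⟨chancellorConfig_satisfies hi, fun k => by simp [chancellorConfig], fun k r _ => ?_⟩
  by_cases hk : k = q <;> simp [chancellorConfig, hk]

theorem Compatible.eq_chancellorConfig {c : Config} {q : Fin 5} {i : Bif} (h : Compatible c i)
    (hi : ICh q i) : c = chancellorConfig q i := by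
  have hl : ∀ k, c.lch k = (chancellorConfig q i).lch k := fun k => by
    by_cases hk : k = q
    · simp [chancellorConfig, hk, h.lch_eq_one hi]
    · simp [chancellorConfig, hk, h.lch_eq_zero hi hk]
  have hp : ∀ k, c.lpr k = 0 := h.lpr_eq_zero hi
  have hv : ∀ k r, c.vch k r = (chancellorConfig q i).vch k r ∧
      c.vpr k r = (chancellorConfig q i).vpr k r := fun k r => by
    by_cases hrk : r = k
    · subst hrk
      simp only [Config.vch_diag, Config.vpr_diag, and_self]
    · by_cases hk : k = q
      · have := (h.2.2 k r hrk).2.1 ⟨by simp [hl, chancellorConfig, hk], hp k⟩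
        simpa [chancellorConfig, hk] using this
      · have := (h.2.2 k r hrk).1 ⟨by simp [hl, chancellorConfig, hk], hp k⟩
        simpa [chancellorConfig, hk] using this
  obtain ⟨vch, vpr, lch, lpr⟩ := c
  have e1 : vch = (chancellorConfig q i).vch := funext₂ fun k r => (hv k r).1
  have e2 : vpr = (chancellorConfig q i).vpr := funext₂ fun k r => (hv k r).2
  have e3 : lch = (chancellorConfig q i).lch := funext hl
  have e4 : lpr = (chancellorConfig q i).lpr := funext hp
  subst e1 e2 e3 e4
  rfl

/-- If the bifurcation choice lies in I_ch^q, there is exactly one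
compatible configuration. -/
theorem ICh_unique_config (q : Fin 5) (i : Bif) (hi : ICh q i) :
    ∃! c : Config, Compatible c i :=
  ⟨chancellorConfig q i, chancellorConfig_compatible hi, fun _ h => h.eq_chancellorConfig hi⟩
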